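/- In the correlated stochastic block model, let p = o(1), q = o(1), s ∈ [0,1] and ε ∈ (0,1) satisfy n·s²·(p+(k−1)q)/k > (1+ε)·(1−ε)^{−2}·log n. Then for all sufficiently large n, for every community labeling σ satisfying the balancedness event F_ε, every ground-truth permutation π_* (τ_* = ℓ(π_*)), and all nonnegative integers x_1,…,x_k with x_r ≤ (ε/2)·|V_r| for every r ∈ [k], one has P(τ̂ ∈ S_{x_1,…,x_k} | σ, τ_*) ≤ n^{−ε·(x_1+⋯+x_k)}. -/

import Mathlib

open Finset Filter

namespace CSBM

/-- Unordered pairs of distinct vertices of `[n]`, encoded as ordered pairs `(i,j)` with `i < j`. -/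
abbrev Edge (n : ℕ) := {e : Fin n × Fin n // e.1 < e.2}

/-- Bernoulli weight: probability of outcome `b` under a `Bernoulli(p)` variable. -/
noncomputable def bern (p : ℝ) (b : Bool) : ℝ := if b then p else 1 - p

/-- Edge indicator between two vertices for a graph encoded on ordered pairs `i < j`. -/
def adj {n : ℕ} (g : Edge n → Bool) (i j : Fin n) : Bool :=
  if h : i < j then g ⟨(i, j), h⟩ else if h' : j < i then g ⟨(j, i), h'⟩ else false

/-- The lifted permutation `ℓ(π)` acting on unordered pairs. -/
def lift {n : ℕ} (π : Equiv.Perm (Fin n)) (e : Edge n) : Edge n :=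
  if h : π e.1.1 < π e.1.2 then ⟨(π e.1.1, π e.1.2), h⟩
  else ⟨(π e.1.2, π e.1.1),
    lt_of_le_of_ne (not_lt.mp h) fun hc => e.2.ne' (π.injective hc)⟩

/-- Outcome of the correlated SBM: community labels, parent graph, and two subsampling masks. -/
abbrev Omega (n k : ℕ) := (Fin n → Fin k) × (Edge n → Bool) × (Edge n → Bool) × (Edge n → Bool)

/-- Joint density (probability mass) of `CSBM(n,p,q,k,s)`: labels i.i.d. uniform on `[k]`,
parent edges Bernoulli `p`/`q` according to labels, two independent `s`-subsampling masks. -/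
noncomputable def density (n k : ℕ) (p q s : ℝ) (ω : Omega n k) : ℝ :=
  ((k : ℝ))⁻¹ ^ n
    * (∏ e : Edge n, bern (if ω.1 e.1.1 = ω.1 e.1.2 then p else q) (ω.2.1 e))
    * (∏ e : Edge n, bern s (ω.2.2.1 e))
    * (∏ e : Edge n, bern s (ω.2.2.2 e))

/-- Probability of an event under `CSBM(n,p,q,k,s)` (with the ground-truth permutation being
a fixed parameter, entering only through observables). -/
noncomputable def Pr (n k : ℕ) (p q s : ℝ) (A : Set (Omega n k)) : ℝ :=
  ∑ ω : Omega n k, Set.indicator A (density n k p q s) ω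

/-- Adjacency matrix of `G₁` (first subsample of the parent graph). -/
def G1adj {n k : ℕ} (ω : Omega n k) : Fin n → Fin n → Bool :=
  fun i j => adj ω.2.1 i j && adj ω.2.2.1 i j

/-- Adjacency matrix of `G₂'` (second subsample of the parent graph, unpermuted). -/
def G2primeAdj {n k : ℕ} (ω : Omega n k) : Fin n → Fin n → Bool :=
  fun i j => adj ω.2.1 i j && adj ω.2.2.2 i j

/-- Adjacency matrix of `G₂`: the second subsample with vertices relabeled by `π`. -/
def G2adj {n k : ℕ} (π : Equiv.Perm (Fin n)) (ω : Omega n k) : Fin n → Fin n → Bool :=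
  fun i j => G2primeAdj ω (π.symm i) (π.symm j)

/-- Alignment score `Σ_{i<j} A_{i,j} B_{π(i),π(j)}`. -/
def align {n : ℕ} (A B : Fin n → Fin n → Bool) (π : Equiv.Perm (Fin n)) : ℕ :=
  ∑ e : Edge n, (if A e.1.1 e.1.2 && B (π e.1.1) (π e.1.2) then 1 else 0)


/-- Outcome of the correlated SBM conditionally on the labels: parent graph and two masks. -/
abbrev CondOmega (n : ℕ) := (Edge n → Bool) × (Edge n → Bool) × (Edge n → Bool)

/-- Conditional density of the correlated SBM given the community labeling `σ`. -/
noncomputable def condDensity (n k : ℕ) (σ : Fin n → Fin k) (p q s : ℝ)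
    (ω : CondOmega n) : ℝ :=
  (∏ e : Edge n, bern (if σ e.1.1 = σ e.1.2 then p else q) (ω.1 e))
    * (∏ e : Edge n, bern s (ω.2.1 e))
    * (∏ e : Edge n, bern s (ω.2.2 e))

/-- Conditional probability of an event given the labels `σ` (and the ground truth `π⋆`,
which enters only through observables). -/
noncomputable def condPr (n k : ℕ) (σ : Fin n → Fin k) (p q s : ℝ)
    (A : Set (CondOmega n)) : ℝ :=
  ∑ ω : CondOmega n, Set.indicator A (condDensity n k σ p q s) ω

/-- Adjacency matrix of `G₁` in the conditional model. -/
def G1adjC {n : ℕ} (ω : CondOmega n) : Fin n → Fin n → Bool :=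
  fun i j => adj ω.1 i j && adj ω.2.1 i j

/-- Adjacency matrix of `G₂` (second subsample, relabeled by `π⋆`) in the conditional model. -/
def G2adjC {n : ℕ} (πstar : Equiv.Perm (Fin n)) (ω : CondOmega n) : Fin n → Fin n → Bool :=
  fun i j => adj ω.1 (πstar.symm i) (πstar.symm j) && adj ω.2.2 (πstar.symm i) (πstar.symm j)

/-- `|V_r|`: size of the `r`-th community. -/
def Vcard {n k : ℕ} (σ : Fin n → Fin k) (r : Fin k) : ℕ :=
  (univ.filter fun i => σ i = r).card

/-- `x_r`: number of vertices of community `r` mismatched by `π` relative to `π⋆`. -/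
def xcount {n k : ℕ} (σ : Fin n → Fin k) (πstar π : Equiv.Perm (Fin n)) (r : Fin k) : ℕ :=
  (univ.filter fun i => σ i = r ∧ π i ≠ πstar i).card

/-- `M⁺(τ)`: number of intra-community pairs moved differently by `ℓ(π)` and `ℓ(π⋆)`. -/
def Mplus {n k : ℕ} (σ : Fin n → Fin k) (πstar π : Equiv.Perm (Fin n)) : ℕ :=
  (univ.filter fun e : Edge n => σ e.1.1 = σ e.1.2 ∧ lift π e ≠ lift πstar e).card

/-- `M⁻(τ)`: number of inter-community pairs moved differently by `ℓ(π)` and `ℓ(π⋆)`. -/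
def Mminus {n k : ℕ} (σ : Fin n → Fin k) (πstar π : Equiv.Perm (Fin n)) : ℕ :=
  (univ.filter fun e : Edge n => σ e.1.1 ≠ σ e.1.2 ∧ lift π e ≠ lift πstar e).card


lemma resample {E : Type*} [Fintype E] [DecidableEq E] (P : E → Bool → ℝ)
    (hP : ∀ e, P e true + P e false = 1) (F : (E → Bool) → ℝ) (e : E) :
    ∑ a : E → Bool, (∏ d, P d (a d)) * F a =
    ∑ a : E → Bool, (∏ d, P d (a d)) *
      (P e true * F (Function.update a e true) + P e false * F (Function.update a e false)) := by
  have h1 : ∑ a : E → Bool, (∏ d, P d (a d)) *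
      (P e true * F (Function.update a e true) + P e false * F (Function.update a e false))
      = ∑ x : (E → Bool) × Bool, (∏ d, P d (x.1 d)) * P e x.2 * F (Function.update x.1 e x.2) := by
    rw [Fintype.sum_prod_type]
    refine Finset.sum_congr rfl fun a _ => ?_
    simp only [Fintype.sum_bool]
    ring
  have h2 : ∑ a : E → Bool, (∏ d, P d (a d)) * F a
      = ∑ x : (E → Bool) × Bool, (∏ d, P d (x.1 d)) * P e x.2 * F x.1 := by
    rw [Fintype.sum_prod_type]
    refine Finset.sum_congr rfl fun a _ => ?_
    simp only [Fintype.sum_bool]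
    linear_combination (-(∏ d, P d (a d)) * F a) * hP e
  rw [h1, h2]
  have hinv : Function.Involutive
      (fun x : (E → Bool) × Bool => (Function.update x.1 e x.2, x.1 e)) := by
    rintro ⟨a, b⟩
    simp
  symm
  refine Fintype.sum_equiv hinv.toPerm _ _ ?_
  rintro ⟨a, b⟩
  simp only [Function.Involutive.coe_toPerm]
  congr 1
  rw [← Finset.mul_prod_erase univ (fun d => P d (a d)) (mem_univ e),
    ← Finset.mul_prod_erase univ (fun d => P d (Function.update a e b d)) (mem_univ e)]
  have : ∏ d ∈ univ.erase e, P d (Function.update a e b d) = ∏ d ∈ univ.erase e, P d (a d) := by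
    refine Finset.prod_congr rfl fun d hd => ?_
    rw [Function.update_of_ne (Finset.ne_of_mem_erase hd)]
  rw [this]
  simp only [Function.update_self]
  ring

noncomputable def pw (c : ℝ) (b : Bool) : ℝ := if b then c else 1

noncomputable def lk {E : Type*} [DecidableEq E] (τ : Equiv.Perm E) (φ : Bool → Bool → ℝ)
    (κ C : ℝ) (S : Finset E) (a : E → Bool) (d : E) : ℝ :=
  if d ∈ S then (if τ.symm d ∈ S then φ (a d) (a (τ.symm d)) else pw κ (a d))
  else (if τ.symm d ∈ S then pw C (a (τ.symm d)) else 1)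

lemma pw_nonneg {c : ℝ} (h : 0 ≤ c) (b : Bool) : 0 ≤ pw c b := by
  unfold pw; split_ifs <;> linarith

lemma lk_nonneg {E : Type*} [DecidableEq E] (τ : Equiv.Perm E) (φ : Bool → Bool → ℝ)
    (κ C : ℝ) (hφ : ∀ a b, 0 ≤ φ a b) (hκ : 0 ≤ κ) (hC : 0 ≤ C)
    (S : Finset E) (a : E → Bool) (d : E) : 0 ≤ lk τ φ κ C S a d := by
  unfold lk
  split_ifs <;> first | exact hφ _ _ | exact pw_nonneg hκ _ | exact pw_nonneg hC _ | norm_num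

lemma elim {E : Type*} [Fintype E] [DecidableEq E] (P : E → Bool → ℝ)
    (hP : ∀ e, P e true + P e false = 1) (hP0 : ∀ e b, 0 ≤ P e b) (τ : Equiv.Perm E)
    (φ : Bool → Bool → ℝ) (κ C : ℝ) (hφ : ∀ a b, 0 ≤ φ a b) (hκ : 0 ≤ κ) (hC : 0 ≤ C)
    (l : E → ℝ) (hl : ∀ e, 0 ≤ l e)
    (h1 : ∀ e a'' a', P e true * (φ true a' * φ a'' true) + P e false * (φ false a' * φ a'' false)
      ≤ l e * (pw C a' * pw κ a''))
    (h2 : ∀ e a'', P e true * (pw κ true * φ a'' true) + P e false * (pw κ false * φ a'' false)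
      ≤ l e * (1 * pw κ a''))
    (h3 : ∀ e a', P e true * (φ true a' * pw C true) + P e false * (φ false a' * pw C false)
      ≤ l e * (pw C a' * 1))
    (h4 : ∀ e, P e true * (pw κ true * pw C true) + P e false * (pw κ false * pw C false)
      ≤ l e * (1 * 1))
    (S : Finset E) (hS : ∀ e ∈ S, τ e ≠ e) :
    ∑ a : E → Bool, (∏ d, P d (a d)) * ∏ d, lk τ φ κ C S a d ≤ ∏ e ∈ S, l e := by
  induction S using Finset.induction_on with
  | empty =>
    simp only [lk, Finset.notMem_empty, if_false, Finset.prod_const_one, mul_one, Finset.prod_empty]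
    have := Finset.prod_univ_sum (fun _ : E => (univ : Finset Bool)) (fun e b => P e b)
    rw [Fintype.piFinset_univ] at this
    rw [← this]
    simp [hP]
  | insert e S he ih =>
    have ih' := ih fun d hd => hS d (Finset.mem_insert_of_mem hd)
    have hte : τ e ≠ e := hS e (Finset.mem_insert_self _ _)
    rw [Finset.prod_insert he, resample P hP _ e]
    refine le_trans ?_ (mul_le_mul_of_nonneg_left ih' (hl e))
    rw [Finset.mul_sum]
    refine Finset.sum_le_sum fun a _ => ?_
    rw [mul_left_comm]
    refine mul_le_mul_of_nonneg_left ?_ (Finset.prod_nonneg fun d _ => hP0 _ _)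
    have hsp : ∀ f : E → ℝ, ∏ d, f d = (f e * f (τ e)) * ∏ d ∈ (univ.erase e).erase (τ e), f d := by
      intro f
      rw [mul_assoc, Finset.mul_prod_erase _ _ (by simp [hte]), Finset.mul_prod_erase _ _ (mem_univ e)]
    have hrest : ∀ b, ∏ d ∈ (univ.erase e).erase (τ e),
        lk τ φ κ C (insert e S) (Function.update a e b) d
        = ∏ d ∈ (univ.erase e).erase (τ e), lk τ φ κ C S a d := by
      intro b
      refine Finset.prod_congr rfl fun d hd => ?_
      simp only [Finset.mem_erase, mem_univ, and_true] at hd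
      have hd' : τ.symm d ≠ e := fun h => hd.1 (by rw [← h]; simp)
      simp [lk, hd.2, hd', Finset.mem_insert, Function.update_of_ne]
    rw [hsp, hsp, hsp, hrest, hrest]
    have hR : 0 ≤ ∏ d ∈ (univ.erase e).erase (τ e), lk τ φ κ C S a d :=
      Finset.prod_nonneg fun d _ => lk_nonneg τ φ κ C hφ hκ hC _ _ _
    generalize (∏ d ∈ (univ.erase e).erase (τ e), lk τ φ κ C S a d) = R at hR
    suffices hk : P e true * (lk τ φ κ C (insert e S) (Function.update a e true) e *
          lk τ φ κ C (insert e S) (Function.update a e true) (τ e)) +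
        P e false * (lk τ φ κ C (insert e S) (Function.update a e false) e *
          lk τ φ κ C (insert e S) (Function.update a e false) (τ e))
        ≤ l e * (lk τ φ κ C S a e * lk τ φ κ C S a (τ e)) by
      have := mul_le_mul_of_nonneg_right hk hR
      linarith
    have hse : τ.symm e ≠ e := fun h => hte (by rw [Equiv.symm_apply_eq] at h; exact h.symm)
    by_cases c1 : τ.symm e ∈ S <;> by_cases c2 : τ e ∈ S
    · simpa [lk, he, c1, c2, hte, hse] using h1 e (a (τ e)) (a (τ.symm e))
    · simpa [lk, he, c1, c2, hte, hse] using h3 e (a (τ.symm e))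
    · simpa [lk, he, c1, c2, hte, hse] using h2 e (a (τ e))
    · simpa [lk, he, c1, c2, hte, hse] using h4 e

/-- fibre lemma -/
lemma fibre {E T : Type*} [Fintype E] [DecidableEq E] [Fintype T]
    (w : E → T → ℝ) (A : T → Bool) (g : T → Bool → ℝ) (τ : Equiv.Perm E) :
    ∑ t : E → T, (∏ e, w e (t e)) * ∏ e, g (t e) (A (t (τ.symm e))) =
    ∑ a : E → Bool, ∏ e, ∑ t : T, if A t = a e then w e t * g t (a (τ.symm e)) else 0 := by
  have : ∀ a : E → Bool, (∏ e, ∑ t : T, if A t = a e then w e t * g t (a (τ.symm e)) else 0)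
      = ∑ t : E → T, if (fun e => A (t e)) = a then
        (∏ e, w e (t e)) * ∏ e, g (t e) (A (t (τ.symm e))) else 0 := by
    intro a
    have := Finset.prod_univ_sum (fun _ : E => (univ : Finset T))
      (fun e t => if A t = a e then w e t * g t (a (τ.symm e)) else 0)
    rw [Fintype.piFinset_univ] at this
    rw [this]
    refine Finset.sum_congr rfl fun t _ => ?_
    split_ifs with h
    · subst h
      simp [Finset.prod_mul_distrib]
    · obtain ⟨e, hne⟩ := Function.ne_iff.mp h
      exact Finset.prod_eq_zero (mem_univ e) (if_neg hne)
  simp_rw [this]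
  rw [Finset.sum_comm]
  refine Finset.sum_congr rfl fun t _ => ?_
  simp

noncomputable def phi (u W : ℝ) (a a' : Bool) : ℝ :=
  if a then (if a' then 1 else u) else (if a' then W else 1)

set_option maxHeartbeats 1000000 in
lemma nums (δ s α : ℝ) (hδ : 0 < δ) (hδ1 : δ < 1) (hs : 0 ≤ s) (hs1 : s ≤ 1) (hα : 0 ≤ α)
    (hα1 : α ≤ δ / 20 * s) (u W κ C l : ℝ) (hu : u = 1 - s * (1 - δ / 8))
    (hW : W = 1 + δ / 20 * s) (hκ : κ = 1 - (1 - δ / 2) * s) (hC : C = 1 + δ / 4 * s)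
    (hl : l = 1 - (1 - δ) * (α * s)) :
    (∀ a'' a', α * (phi u W true a' * phi u W a'' true)
        + (1 - α) * (phi u W false a' * phi u W a'' false) ≤ l * (pw C a' * pw κ a'')) ∧
    (∀ a'', α * (pw κ true * phi u W a'' true) + (1 - α) * (pw κ false * phi u W a'' false)
      ≤ l * (1 * pw κ a'')) ∧
    (∀ a', α * (phi u W true a' * pw C true) + (1 - α) * (phi u W false a' * pw C false)
      ≤ l * (pw C a' * 1)) ∧
    (α * (pw κ true * pw C true) + (1 - α) * (pw κ false * pw C false) ≤ l * (1 * 1)) := by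
  have hds : 0 ≤ δ * s := by positivity
  have hss : s * s ≤ s := by nlinarith
  have hss0 : 0 ≤ s * s := by positivity
  have hdss : δ * s * s ≤ δ * s := by nlinarith
  have hds1 : δ * s ≤ s := by nlinarith
  have hd2 : δ * s * (δ * s) ≤ δ * s := by nlinarith
  have hd20 : 0 ≤ δ * s * (δ * s) := by positivity
  have gen : ∀ t, t ≤ 1 - (1 - δ) * s → (1 - α) + α * t ≤ l := by
    intro t ht
    have := mul_le_mul_of_nonneg_left ht hα
    rw [hl]; linarith
  have hl1 : 1 - δ / 20 * s ≤ l := by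
    have : α * s ≤ α := by nlinarith
    have h0 : 0 ≤ α * s := by positivity
    have : (1 - δ) * (α * s) ≤ α * s := by nlinarith
    linarith
  have hu0 : 0 ≤ u := by rw [hu]; nlinarith
  have hu1 : u ≤ 1 := by rw [hu]; nlinarith
  have hκ0 : 0 ≤ κ := by rw [hκ]; nlinarith
  have hκ1 : κ ≤ 1 := by rw [hκ]; nlinarith
  have hC1 : 1 ≤ C := by rw [hC]; linarith
  have hC2 : C ≤ 2 := by rw [hC]; linarith
  have hα2 : α ≤ 1 := by linarith
  have huW : u * W ≤ 1 - s * (1 - δ / 8) + δ / 20 * s := by rw [hW]; nlinarith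
  have hκW : κ * W ≤ 1 - (1 - δ / 2) * s + δ / 20 * s := by rw [hW]; nlinarith
  have huC : u * C ≤ 1 - s * (1 - δ / 8) + δ / 4 * s := by rw [hC]; nlinarith
  have hκC : κ * C ≤ 1 - (1 - δ / 2) * s + δ / 4 * s := by rw [hC]; nlinarith
  have hlC : 1 + δ / 4 * s - 2 * (δ / 20 * s) ≤ l * C := by
    have := mul_le_mul_of_nonneg_right hl1 (by linarith : 0 ≤ C)
    nlinarith
  have hlκ : 1 - (1 - δ / 2) * s - δ / 20 * s ≤ l * κ := by
    have := mul_le_mul_of_nonneg_right hl1 hκ0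
    nlinarith
  have hlκ0 : 0 ≤ l * κ := mul_nonneg (by linarith) hκ0
  have hW0 : 0 ≤ W := by rw [hW]; linarith
  have huW0 : 0 ≤ u * W := mul_nonneg hu0 hW0
  have hακ : α * κ ≤ α := mul_le_of_le_one_right hα hκ1
  have hαu : 0 ≤ α * u := by positivity
  have hαuW : 0 ≤ α * (u * W) := by positivity
  have hαW : 0 ≤ α * W := by positivity
  have hαC : α * C ≤ 2 * α := by linarith [mul_le_mul_of_nonneg_left hC2 hα]
  refine ⟨?_, ?_, ?_, ?_⟩
  · rintro (_ | _) (_ | _) <;> simp only [phi, pw, if_true, Bool.false_eq_true, if_false]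
    · have := gen (u * W) (by linarith)
      linarith
    · linarith
    · linarith
    · have : l * κ ≤ l * κ * C := le_mul_of_one_le_right hlκ0 hC1
      linarith
  · rintro (_ | _) <;> simp only [phi, pw, if_true, Bool.false_eq_true, if_false]
    · have := gen (κ * W) (by linarith)
      linarith
    · linarith
  · rintro (_ | _) <;> simp only [phi, pw, if_true, Bool.false_eq_true, if_false]
    · have := gen (u * C) (by linarith)
      linarith
    · linarith
  · simp only [pw, if_true, Bool.false_eq_true, if_false]
    have := gen (κ * C) (by linarith)
    linarith

noncomputable def wt {E : Type*} (pe : E → ℝ) (s : ℝ) (e : E) (t : Bool × Bool × Bool) : ℝ :=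
  bern (pe e) t.1 * bern s t.2.1 * bern s t.2.2

def At (t : Bool × Bool × Bool) : Bool := t.1 && t.2.1
def Bt (t : Bool × Bool × Bool) : Bool := t.1 && t.2.2

noncomputable def gt (z : ℝ) (t : Bool × Bool × Bool) (a' : Bool) : ℝ :=
  if Bt t then pw z a' * pw z⁻¹ (At t) else 1

lemma bern_nonneg {p : ℝ} (h : p ∈ Set.Icc (0 : ℝ) 1) (b : Bool) : 0 ≤ bern p b := by
  unfold bern; split_ifs
  · exact h.1
  · linarith [h.2]

lemma moment {E : Type*} [Fintype E] [DecidableEq E] (pe : E → ℝ) (s δ : ℝ)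
    (hδ : 0 < δ) (hδ1 : δ < 1) (hs : 0 ≤ s) (hs1 : s ≤ 1)
    (hp : ∀ e, 0 ≤ pe e) (hp1 : ∀ e, pe e ≤ δ ^ 2 / 320) (τ : Equiv.Perm E) :
    ∑ t : E → Bool × Bool × Bool,
      (∏ e, wt pe s e (t e)) * ∏ e, gt (8 / δ) (t e) (At (t (τ.symm e)))
    ≤ ∏ e ∈ univ.filter (fun e => τ e ≠ e), (1 - (1 - δ) * (pe e * s * s)) := by
  rw [fibre]
  set u : ℝ := 1 - s * (1 - δ / 8) with hu
  set W : ℝ := 1 + δ / 20 * s with hW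
  set κ : ℝ := 1 - (1 - δ / 2) * s with hκ
  set C : ℝ := 1 + δ / 4 * s with hC
  set P : E → Bool → ℝ := fun e b => if b then pe e * s else 1 - pe e * s with hPd
  have hp2 : ∀ e, pe e ≤ δ / 320 := fun e => (hp1 e).trans (by nlinarith)
  have hα0 : ∀ e, 0 ≤ pe e * s := fun e => mul_nonneg (hp e) hs
  have hα1 : ∀ e, pe e * s ≤ δ / 20 * s := fun e =>
    mul_le_mul_of_nonneg_right ((hp2 e).trans (by linarith)) hs
  have hα2 : ∀ e, pe e * s ≤ 1 / 2 := fun e => (hα1 e).trans (by nlinarith)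
  have hu0 : 0 ≤ u := by rw [hu]; nlinarith
  have hW0 : 0 ≤ W := by rw [hW]; positivity
  have hP0 : ∀ e b, 0 ≤ P e b := by
    intro e b
    simp only [hPd]
    split_ifs
    · exact hα0 e
    · linarith [hα2 e]
  have hφ : ∀ a b, 0 ≤ phi u W a b := by
    intro a b
    unfold phi
    split_ifs <;> first | assumption | norm_num
  have hN := fun e => nums δ s (pe e * s) hδ hδ1 hs hs1 (hα0 e) (hα1 e) u W κ C
    (1 - (1 - δ) * (pe e * s * s)) hu hW hκ hC rfl
  have hQ : ∀ e a a', (∑ t : Bool × Bool × Bool,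
      if At t = a then wt pe s e t * gt (8 / δ) t a' else 0) ≤ P e a * phi u W a a' := by
    intro e a a'
    have hz : (8 / δ)⁻¹ = δ / 8 := by rw [inv_div]
    have hzz : 8 / δ * (δ / 8) = 1 := by field_simp
    have hkey : pe e * (8 / δ) ≤ δ / 40 := by
      rw [mul_div_assoc', div_le_iff₀ hδ]
      nlinarith [hp1 e]
    have hz0 : 0 < 8 / δ := by positivity
    generalize 8 / δ = z at *
    cases a <;> cases a' <;>
      simp [Fintype.sum_prod_type, wt, gt, At, Bt, bern, pw, phi, hPd, hz, hzz, hu, hW] 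
    · apply le_of_eq; ring
    · have h1 : pe e * s * ((1 - s) * z) ≤ s * (δ / 40) := by
        have : pe e * s * ((1 - s) * z) ≤ pe e * s * z := by
          apply mul_le_mul_of_nonneg_left _ (hα0 e)
          nlinarith
        nlinarith
      have h2 : pe e * s * (δ / 20 * s) ≤ 1 / 2 * (δ / 20 * s) :=
        mul_le_mul_of_nonneg_right (hα2 e) (by positivity)
      have h3 : 0 ≤ pe e * s * (1 - s) := mul_nonneg (hα0 e) (by linarith)
      nlinarith
    · apply le_of_eq; ring
    · apply le_of_eq; ring
  have hwt0 : ∀ e t, 0 ≤ wt pe s e t := by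
    intro e t
    have : pe e ∈ Set.Icc (0 : ℝ) 1 := ⟨hp e, by linarith [hp2 e]⟩
    exact mul_nonneg (mul_nonneg (bern_nonneg this _) (bern_nonneg ⟨hs, hs1⟩ _))
      (bern_nonneg ⟨hs, hs1⟩ _)
  have hgt0 : ∀ t a', 0 ≤ gt (8 / δ) t a' := by
    intro t a'
    unfold gt
    split_ifs
    · exact mul_nonneg (pw_nonneg (by positivity) _) (pw_nonneg (by positivity) _)
    · norm_num
  have hE := elim P (fun e => by simp [hPd]) hP0 τ (phi u W) κ C hφ
    (by rw [hκ]; nlinarith) (by rw [hC]; positivity)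
    (fun e => 1 - (1 - δ) * (pe e * s * s))
    (fun e => by
      have h1 : pe e * s * s ≤ 1 := by nlinarith [hα2 e, hα0 e]
      have h0 : 0 ≤ pe e * s * s := mul_nonneg (hα0 e) hs
      show 0 ≤ 1 - (1 - δ) * (pe e * s * s)
      nlinarith)
    (fun e => by simpa [hPd] using (hN e).1)
    (fun e => by simpa [hPd] using (hN e).2.1)
    (fun e => by simpa [hPd] using (hN e).2.2.1)
    (fun e => by simpa [hPd] using (hN e).2.2.2)
    (univ.filter (fun e => τ e ≠ e)) (by simp)
  refine le_trans (Finset.sum_le_sum fun a _ => ?_) hE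
  rw [← Finset.prod_mul_distrib]
  refine Finset.prod_le_prod (fun e _ => Finset.sum_nonneg fun t _ => ?_) fun e _ => ?_
  · split_ifs
    · exact mul_nonneg (hwt0 _ _) (hgt0 _ _)
    · exact le_rfl
  · refine (hQ e _ _).trans (le_of_eq ?_)
    congr 1
    by_cases h : τ e = e
    · have h' : τ.symm e = e := by rw [Equiv.symm_apply_eq]; exact h.symm
      simp only [lk, Finset.mem_filter, mem_univ, true_and, h', h, ne_eq, not_true_eq_false, if_false]
      unfold phi; split_ifs <;> rfl
    · have h' : τ (τ.symm e) ≠ τ.symm e := by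
        intro hh; apply h
        rw [Equiv.apply_symm_apply] at hh
        conv_lhs => rw [hh, Equiv.apply_symm_apply]
      simp only [lk, Finset.mem_filter, mem_univ, true_and, h', h, ne_eq, not_false_eq_true, if_true]

lemma lift_eq_iff {n : ℕ} (π : Equiv.Perm (Fin n)) (e f : Edge n) :
    lift π e = f ↔ (s(π e.1.1, π e.1.2) = s(f.1.1, f.1.2)) := by
  obtain ⟨⟨i, j⟩, hij⟩ := e
  obtain ⟨⟨k, l⟩, hkl⟩ := f
  simp only [lift]
  simp only at hij hkl
  split_ifs with h
  · simp only [Subtype.mk.injEq, Prod.mk.injEq, Sym2.eq_iff]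
    constructor
    · exact Or.inl
    · rintro (h' | ⟨h1, h2⟩)
      · exact h'
      · rw [h1, h2] at h; exact absurd h (lt_asymm hkl)
  · simp only [Subtype.mk.injEq, Prod.mk.injEq, Sym2.eq_iff]
    constructor
    · rintro ⟨h1, h2⟩; exact Or.inr ⟨h2, h1⟩
    · rintro (⟨h1, h2⟩ | ⟨h1, h2⟩)
      · rw [h1, h2] at h; exact absurd hkl h
      · exact ⟨h2, h1⟩

lemma edge_ext {n : ℕ} (e f : Edge n) (h : s(e.1.1, e.1.2) = s(f.1.1, f.1.2)) : e = f := by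
  have := (lift_eq_iff (Equiv.refl _) e f).2 h
  rw [← this, eq_comm, lift_eq_iff]
  rfl

lemma lift_mk {n : ℕ} (π : Equiv.Perm (Fin n)) (e : Edge n) :
    s((lift π e).1.1, (lift π e).1.2) = s(π e.1.1, π e.1.2) :=
  ((lift_eq_iff π e _).1 rfl).symm

lemma lift_injective {n : ℕ} (π : Equiv.Perm (Fin n)) : Function.Injective (lift π) := by
  intro e f h
  rw [lift_eq_iff, lift_mk] at h
  apply edge_ext
  have := congrArg (Sym2.map π.symm) h
  simpa using this

noncomputable def liftE {n : ℕ} (π : Equiv.Perm (Fin n)) : Equiv.Perm (Edge n) :=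
  Equiv.ofBijective (lift π) (Finite.injective_iff_bijective.mp (lift_injective π))

lemma adj_lift {n : ℕ} (g : Edge n → Bool) (π : Equiv.Perm (Fin n)) (e : Edge n) :
    adj g (π e.1.1) (π e.1.2) = g (lift π e) := by
  unfold adj lift
  split_ifs with h h'
  · rfl
  · rfl
  · exact absurd (π.injective (le_antisymm (not_lt.mp h') (not_lt.mp h))) e.2.ne

lemma adj_self {n : ℕ} (g : Edge n → Bool) (e : Edge n) : adj g e.1.1 e.1.2 = g e := by
  unfold adj
  rw [dif_pos e.2]

def unz {n : ℕ} : CondOmega n ≃ (Edge n → Bool × Bool × Bool) where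
  toFun ω e := (ω.1 e, ω.2.1 e, ω.2.2 e)
  invFun t := (fun e => (t e).1, fun e => (t e).2.1, fun e => (t e).2.2)
  left_inv _ := rfl
  right_inv _ := rfl

lemma align_eq {n : ℕ} (πstar π : Equiv.Perm (Fin n)) (ω : CondOmega n) :
    align (G1adjC ω) (G2adjC πstar ω) π
      = ∑ e : Edge n, if At (unz ω e) && Bt (unz ω (lift (πstar⁻¹ * π) e)) then 1 else 0 := by
  unfold align
  refine Finset.sum_congr rfl fun e _ => ?_
  have h : ∀ g : Edge n → Bool, adj g (πstar.symm (π e.1.1)) (πstar.symm (π e.1.2))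
      = g (lift (πstar⁻¹ * π) e) := fun g => adj_lift g (πstar⁻¹ * π) e
  simp only [G1adjC, G2adjC, h, adj_self, At, Bt, unz, Equiv.coe_fn_mk]
  rfl

lemma lift_one {n : ℕ} (e : Edge n) : lift (1 : Equiv.Perm (Fin n)) e = e := by
  rw [lift_eq_iff]; rfl

lemma align_congr {n : ℕ} (A B : Fin n → Fin n → Bool) (π π' : Equiv.Perm (Fin n))
    (hB : ∀ i j, B i j = B j i) (h : lift π = lift π') : align A B π = align A B π' := by
  unfold align
  refine Finset.sum_congr rfl fun e _ => ?_
  have h1 : s(π e.1.1, π e.1.2) = s(π' e.1.1, π' e.1.2) := by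
    rw [← lift_mk, ← lift_mk, h]
  rw [Sym2.eq_iff] at h1
  rcases h1 with ⟨h1, h2⟩ | ⟨h1, h2⟩
  · rw [h1, h2]
  · rw [h1, h2, hB]

lemma adj_symm {n : ℕ} (g : Edge n → Bool) (i j : Fin n) : adj g i j = adj g j i := by
  unfold adj
  split_ifs with h1 h2
  · exact absurd h1 (lt_asymm h2)
  · rfl
  · rfl
  · rfl

lemma gprod {n : ℕ} (z : ℝ) (t : Edge n → Bool × Bool × Bool) (τ : Equiv.Perm (Edge n)) :
    ∏ e, gt z (t e) (At (t (τ.symm e)))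
      = z ^ (∑ e, if At (t e) && Bt (t (τ e)) then 1 else 0)
        * z⁻¹ ^ (∑ e, if At (t e) && Bt (t e) then 1 else 0) := by
  rw [← Finset.prod_pow_eq_pow_sum, ← Finset.prod_pow_eq_pow_sum]
  have : ∏ e, z ^ (if (At (t e) && Bt (t (τ e))) = true then 1 else 0)
      = ∏ e, z ^ (if (At (t (τ.symm e)) && Bt (t e)) = true then 1 else 0) := by
    refine Fintype.prod_equiv τ _ _ fun e => ?_
    simp
  rw [this, ← Finset.prod_mul_distrib]
  refine Finset.prod_congr rfl fun e _ => ?_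
  unfold gt pw
  cases Bt (t e) <;> cases At (t e) <;> cases At (t (τ.symm e)) <;> simp

/-- edge probabilities -/
noncomputable def pe {n k : ℕ} (σ : Fin n → Fin k) (p q : ℝ) (e : Edge n) : ℝ :=
  if σ e.1.1 = σ e.1.2 then p else q

lemma condDensity_eq {n k : ℕ} (σ : Fin n → Fin k) (p q s : ℝ) (ω : CondOmega n) :
    condDensity n k σ p q s ω = ∏ e, wt (pe σ p q) s e (unz ω e) := by
  unfold condDensity wt pe unz
  rw [← Finset.prod_mul_distrib, ← Finset.prod_mul_distrib]
  rfl

lemma condDensity_nonneg {n k : ℕ} (σ : Fin n → Fin k) (p q s : ℝ)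
    (hp : p ∈ Set.Icc (0 : ℝ) 1) (hq : q ∈ Set.Icc (0 : ℝ) 1) (hs : s ∈ Set.Icc (0 : ℝ) 1)
    (ω : CondOmega n) : 0 ≤ condDensity n k σ p q s ω := by
  unfold condDensity
  refine mul_nonneg (mul_nonneg ?_ ?_) ?_ <;> refine Finset.prod_nonneg fun e _ => bern_nonneg ?_ _
  · split_ifs <;> assumption
  · exact hs
  · exact hs

lemma one_perm {n k : ℕ} (σ : Fin n → Fin k) (p q s δ : ℝ)
    (hp : p ∈ Set.Icc (0 : ℝ) 1) (hq : q ∈ Set.Icc (0 : ℝ) 1) (hs : s ∈ Set.Icc (0 : ℝ) 1)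
    (hδ : 0 < δ) (hδ1 : δ < 1) (hp1 : p ≤ δ ^ 2 / 320) (hq1 : q ≤ δ ^ 2 / 320)
    (πstar π : Equiv.Perm (Fin n)) :
    condPr n k σ p q s {ω | align (G1adjC ω) (G2adjC πstar ω) πstar
        ≤ align (G1adjC ω) (G2adjC πstar ω) π}
    ≤ Real.exp (-((1 - δ) * s ^ 2 *
      ∑ e ∈ univ.filter (fun e => lift (πstar⁻¹ * π) e ≠ e), pe σ p q e)) := by
  have hM := moment (pe σ p q) s δ hδ hδ1 hs.1 hs.2
    (fun e => by unfold pe; split_ifs; exacts [hp.1, hq.1])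
    (fun e => by unfold pe; split_ifs; exacts [hp1, hq1]) (liftE (πstar⁻¹ * π))
  have hpe0 : ∀ e, 0 ≤ pe σ p q e := fun e => by unfold pe; split_ifs; exacts [hp.1, hq.1]
  have hpe1 : ∀ e, pe σ p q e ≤ 1 := fun e => by unfold pe; split_ifs; exacts [hp.2, hq.2]
  have hs0 := hs.1
  have hs1 := hs.2
  have hend : ∏ e ∈ univ.filter (fun e => liftE (πstar⁻¹ * π) e ≠ e),
      (1 - (1 - δ) * (pe σ p q e * s * s)) ≤ Real.exp (-((1 - δ) * s ^ 2 *
      ∑ e ∈ univ.filter (fun e => lift (πstar⁻¹ * π) e ≠ e), pe σ p q e)) := by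
    rw [Finset.mul_sum, ← Finset.sum_neg_distrib, Real.exp_sum]
    refine Finset.prod_le_prod (fun e _ => ?_) fun e _ => ?_
    · have h1 : pe σ p q e * s ≤ 1 := by nlinarith [hpe0 e, hpe1 e]
      have h10 : 0 ≤ pe σ p q e * s := mul_nonneg (hpe0 e) hs0
      have h2 : pe σ p q e * s * s ≤ 1 := by nlinarith
      have h20 : 0 ≤ pe σ p q e * s * s := mul_nonneg h10 hs0
      nlinarith
    · have := Real.add_one_le_exp (-((1 - δ) * s ^ 2 * pe σ p q e))
      refine le_trans (le_of_eq ?_) this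
      ring
  refine le_trans ?_ (hM.trans hend)
  unfold condPr
  rw [← Equiv.sum_comp (unz (n := n))]
  refine Finset.sum_le_sum fun ω _ => ?_
  rw [← condDensity_eq σ p q s ω, gprod]
  have e1 := align_eq πstar π ω
  have e2 := align_eq πstar πstar ω
  simp only [inv_mul_cancel, lift_one] at e2
  have e1' : align (G1adjC ω) (G2adjC πstar ω) π
      = ∑ e : Edge n, if At (unz ω e) && Bt (unz ω (liftE (πstar⁻¹ * π) e)) then 1 else 0 := e1
  rw [← e1', ← e2]
  have hd := condDensity_nonneg σ p q s hp hq hs ω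
  have hz : (1 : ℝ) ≤ 8 / δ := by rw [le_div_iff₀ hδ]; linarith
  have hz0 : (0 : ℝ) < 8 / δ := by positivity
  by_cases h : ω ∈ {ω | align (G1adjC ω) (G2adjC πstar ω) πstar
        ≤ align (G1adjC ω) (G2adjC πstar ω) π}
  · rw [Set.indicator_of_mem h]
    refine le_mul_of_one_le_right hd ?_
    rw [inv_pow, ← div_eq_mul_inv, le_div_iff₀ (by positivity), one_mul]
    exact pow_le_pow_right₀ hz h
  · rw [Set.indicator_of_notMem h]
    positivity

lemma count_perm (n m : ℕ) (πstar : Equiv.Perm (Fin n)) :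
    (univ.filter fun π : Equiv.Perm (Fin n) => (univ.filter fun i => π i ≠ πstar i).card = m).card
      ≤ n ^ m := by
  classical
  have hsub : (univ.filter fun π : Equiv.Perm (Fin n) =>
      (univ.filter fun i => π i ≠ πstar i).card = m)
      ⊆ (powersetCard m (univ : Finset (Fin n))).biUnion fun D =>
        univ.filter fun π : Equiv.Perm (Fin n) => ∀ i, i ∉ D → π i = πstar i := by
    intro π hπ
    simp only [mem_filter, mem_univ, true_and] at hπ
    simp only [mem_biUnion, mem_powersetCard, mem_filter, mem_univ, true_and, subset_univ]
    refine ⟨_, hπ, fun i hi => ?_⟩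
    simpa using hi
  refine (card_le_card hsub).trans ?_
  refine (card_biUnion_le_card_mul _ _ m.factorial ?_).trans ?_
  · intro D hD
    rw [mem_powersetCard] at hD
    have h1 : Fintype.card {f : Equiv.Perm (Fin n) // ∀ a, ¬ (a ∈ D) → f a = a} = m.factorial := by
      rw [← Fintype.card_congr (Equiv.Perm.subtypeEquivSubtypePerm (fun a => a ∈ D)),
        Fintype.card_perm, Fintype.card_coe, hD.2]
    rw [← h1, Fintype.card_subtype]
    refine card_le_card_of_injOn (fun π => πstar⁻¹ * π) ?_ ?_
    · intro π hπ
      simp only [coe_filter, mem_univ, true_and, Set.mem_ofPred_eq] at hπ ⊢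
      intro a ha
      simp [Equiv.Perm.mul_apply, hπ a ha]
    · intro a _ b _ h
      exact mul_left_cancel h
  · rw [card_powersetCard, card_univ, Fintype.card_fin, mul_comm, ← Nat.descFactorial_eq_factorial_mul_choose]
    exact Nat.descFactorial_le_pow n m

lemma pe_sum {n k : ℕ} (σ : Fin n → Fin k) (p q B : ℝ) (hp : 0 ≤ p) (hq : 0 ≤ q)
    (πstar π : Equiv.Perm (Fin n))
    (hB : ∀ r, B ≤ (Vcard σ r : ℝ) - xcount σ πstar π r) :
    (∑ r, (xcount σ πstar π r : ℝ)) * (B * (p + ((k : ℝ) - 1) * q))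
      ≤ ∑ e ∈ univ.filter (fun e => lift (πstar⁻¹ * π) e ≠ e), pe σ p q e := by
  classical
  set ρ := πstar⁻¹ * π with hρ
  have hmv : ∀ i, ρ i ≠ i ↔ π i ≠ πstar i := by
    intro i
    rw [hρ, Equiv.Perm.mul_apply, Ne, Equiv.Perm.inv_eq_iff_eq]
  set D : Finset (Fin n) := univ.filter fun i => π i ≠ πstar i with hD
  have hrow : ∀ i : Fin n, B * (p + ((k : ℝ) - 1) * q)
      ≤ ∑ j ∈ Dᶜ, if σ i = σ j then p else q := by
    intro i
    have h1 : ∑ j ∈ Dᶜ, (if σ i = σ j then p else q)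
        = ∑ r, ((Vcard σ r : ℝ) - xcount σ πstar π r) * (if σ i = r then p else q) := by
      rw [← Finset.sum_fiberwise Dᶜ σ]
      refine Finset.sum_congr rfl fun r _ => ?_
      have : ∑ j ∈ Dᶜ with σ j = r, (if σ i = σ j then p else q)
          = ∑ j ∈ Dᶜ with σ j = r, (if σ i = r then p else q) := by
        refine Finset.sum_congr rfl fun j hj => ?_
        rw [(Finset.mem_filter.mp hj).2]
      rw [this, Finset.sum_const, nsmul_eq_mul]
      congr 1
      have hc : Vcard σ r = (Dᶜ.filter fun j => σ j = r).card + xcount σ πstar π r := by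
        unfold Vcard xcount
        rw [← Finset.card_union_of_disjoint]
        · congr 1
          ext j
          simp only [hD, mem_filter, mem_univ, true_and, mem_union, mem_compl]
          tauto
        · rw [Finset.disjoint_left]
          intro j
          simp only [hD, mem_filter, mem_univ, true_and, mem_compl]
          tauto
      rw [hc]; push_cast; ring
    rw [h1]
    have h2 : ∑ r : Fin k, (if σ i = r then p else q) = p + ((k : ℝ) - 1) * q := by
      have : ∀ r : Fin k, (if σ i = r then p else q) = q + (if σ i = r then p - q else 0) := by
        intro r; split_ifs <;> ring
      simp_rw [this]
      rw [Finset.sum_add_distrib, Finset.sum_ite_eq]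
      simp
      ring
    rw [← h2, Finset.mul_sum]
    refine Finset.sum_le_sum fun r _ => mul_le_mul_of_nonneg_right (hB r) ?_
    split_ifs <;> assumption
  have hx : (∑ r, (xcount σ πstar π r : ℝ)) = D.card := by
    rw [Finset.card_eq_sum_card_fiberwise (f := σ) (t := univ) (fun _ _ => by simp)]
    push_cast
    refine Finset.sum_congr rfl fun r _ => ?_
    have : xcount σ πstar π r = (D.filter fun j => σ j = r).card := by
      unfold xcount
      congr 1
      ext j
      simp only [hD, mem_filter, mem_univ, true_and]
      tauto
    rw [this]
  rw [hx, ← nsmul_eq_mul, ← Finset.sum_const]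
  refine (Finset.sum_le_sum fun i _ => hrow i).trans ?_
  rw [← Finset.sum_product']
  have hne : ∀ x ∈ D ×ˢ Dᶜ, x.1 ≠ x.2 := by
    intro x hx h
    rw [mem_product, mem_compl, h] at hx
    exact hx.2 hx.1
  let f : ∀ x ∈ D ×ˢ Dᶜ, Edge n := fun x hx =>
    if h : x.1 < x.2 then ⟨x, h⟩ else ⟨(x.2, x.1), lt_of_le_of_ne (not_lt.mp h) (hne x hx).symm⟩
  have hf : ∀ x hx, s((f x hx).1.1, (f x hx).1.2) = s(x.1, x.2) := by
    intro x hx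
    simp only [f]
    split_ifs
    · rfl
    · exact Sym2.eq_swap
  have hfpe : ∀ x hx, pe σ p q (f x hx) = if σ x.1 = σ x.2 then p else q := by
    intro x hx
    simp only [f, pe]
    split_ifs <;> simp_all
  have hpe0 : ∀ e, 0 ≤ pe σ p q e := fun e => by unfold pe; split_ifs <;> assumption
  calc ∑ x ∈ D ×ˢ Dᶜ, (if σ x.1 = σ x.2 then p else q)
      = ∑ x ∈ (D ×ˢ Dᶜ).attach, pe σ p q (f x.1 x.2) := by
        rw [← Finset.sum_attach]
        exact Finset.sum_congr rfl fun x _ => (hfpe x.1 x.2).symm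
    _ = ∑ e ∈ (D ×ˢ Dᶜ).attach.image (fun x => f x.1 x.2), pe σ p q e := by
        rw [Finset.sum_image]
        rintro ⟨⟨i, j⟩, hx⟩ _ ⟨⟨i', j'⟩, hy⟩ _ h
        have h1 := hf _ hx
        simp only at h
        rw [h, hf _ hy, Sym2.eq_iff] at h1
        simp only [mem_product, mem_compl] at hx hy
        rcases h1 with ⟨h1, h2⟩ | ⟨h1, h2⟩
        · simp only at h1 h2; subst h1; subst h2; rfl
        · simp only at h1 h2; subst h1; subst h2; exact absurd hy.1 hx.2
    _ ≤ _ := by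
        refine Finset.sum_le_sum_of_subset_of_nonneg ?_ fun e _ _ => hpe0 e
        intro e he
        rw [Finset.mem_image] at he
        obtain ⟨⟨⟨i, j⟩, hx⟩, -, rfl⟩ := he
        rw [Finset.mem_filter]
        refine ⟨mem_univ _, fun h => ?_⟩
        rw [lift_eq_iff] at h
        have h2 : s(ρ i, ρ j) = s(i, j) := by
          have h3 := congrArg (Sym2.map ρ) (hf _ hx)
          have h4 := hf _ hx
          simp only [Sym2.map_mk] at h3
          exact h3.symm.trans (h.trans h4)
        have hi : ρ i ≠ i := by
          rw [hmv]; simpa [hD] using (mem_product.mp hx).1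
        have hj : ρ j = j := by
          by_contra hc
          have := (mem_product.mp hx).2
          rw [mem_compl] at this
          apply this
          simp only [hD, mem_filter, mem_univ, true_and]
          exact (hmv j).1 hc
        rw [hj, Sym2.eq_iff] at h2
        rcases h2 with ⟨h2, -⟩ | ⟨h2, h3⟩
        · exact hi h2
        · rw [h2, h3] at hi
          exact hi rfl

/-- Lemma `lem:prob bound 1`.
Under `p, q = o(1)` and `n s² (p+(k-1)q)/k > (1+ε)(1-ε)⁻² log n`, for all sufficiently
large `n`, every labeling `σ` in the balancedness event `F_ε`, every ground truth `π⋆`, and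
all `x_1,…,x_k` with `x_r ≤ (ε/2)|V_r|` for every `r`, any alignment-maximizing estimator
satisfies `P(τ̂ ∈ S_{x_1,…,x_k} | σ, τ⋆) ≤ n^{-ε(x_1+⋯+x_k)}`. -/
theorem prob_bound_small_x
    (p q s : ℕ → ℝ) (k : ℕ → ℕ)
    (hp01 : ∀ n, p n ∈ Set.Icc (0 : ℝ) 1) (hq01 : ∀ n, q n ∈ Set.Icc (0 : ℝ) 1)
    (hs01 : ∀ n, s n ∈ Set.Icc (0 : ℝ) 1) (hk1 : ∀ n, 1 ≤ k n)
    (hp : Tendsto p atTop (nhds 0)) (hq : Tendsto q atTop (nhds 0))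
    (ε : ℝ) (hε : ε ∈ Set.Ioo (0 : ℝ) 1)
    (hdeg : ∀ᶠ n : ℕ in atTop,
        n * s n ^ 2 * (p n + ((k n : ℝ) - 1) * q n) / k n
          > (1 + ε) * ((1 - ε)⁻¹) ^ 2 * Real.log n) :
    ∀ᶠ n : ℕ in atTop, ∀ σ : Fin n → Fin (k n),
      (∀ r, (1 - ε / 2) * n / k n ≤ (Vcard σ r : ℝ)
          ∧ (Vcard σ r : ℝ) ≤ (1 + ε / 2) * n / k n) →
      ∀ πstar : Equiv.Perm (Fin n), ∀ x : Fin (k n) → ℕ,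
        (∀ r, (x r : ℝ) ≤ ε / 2 * (Vcard σ r : ℝ)) →
        ∀ est : (Fin n → Fin n → Bool) → (Fin n → Fin n → Bool) → Equiv.Perm (Fin n),
          (∀ A B π', align A B π' ≤ align A B (est A B)) →
          condPr n (k n) σ (p n) (q n) (s n)
              {ω | ∃ π : Equiv.Perm (Fin n),
                  lift π = lift (est (G1adjC ω) (G2adjC πstar ω))
                    ∧ ∀ r, xcount σ πstar π r = x r}
            ≤ (n : ℝ) ^ (-(ε * ∑ r, (x r : ℝ))) := by
  obtain ⟨hε0, hε1⟩ := hε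
  set δ : ℝ := ε / 2 with hδ
  have hδ0 : 0 < δ := by rw [hδ]; linarith
  have hδ1 : δ < 1 := by rw [hδ]; linarith
  have hc : (0 : ℝ) < δ ^ 2 / 320 := by positivity
  filter_upwards [hdeg, hp.eventually_le_const hc, hq.eventually_le_const hc,
    eventually_ge_atTop 1] with n hdeg hpn hqn hn1
  intro σ hσ πstar x hx est hest
  classical
  have hn : (1 : ℝ) ≤ n := by exact_mod_cast hn1
  have hn0 : (0 : ℝ) < n := by linarith
  have hL : 0 ≤ Real.log n := Real.log_nonneg hn
  have hk : (1 : ℝ) ≤ k n := by exact_mod_cast hk1 n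
  set m : ℕ := ∑ r, x r with hm
  have hms : (∑ r, (x r : ℝ)) = m := by rw [hm]; push_cast; rfl
  rw [hms]
  set Ps : Finset (Equiv.Perm (Fin n)) :=
    univ.filter fun π => ∀ r, xcount σ πstar π r = x r with hPs
  have hcard : (Ps.card : ℝ) ≤ (n : ℝ) ^ m := by
    have : Ps.card ≤ n ^ m := by
      refine (card_le_card ?_).trans (count_perm n m πstar)
      intro π hπ
      simp only [hPs, mem_filter, mem_univ, true_and] at hπ ⊢
      rw [Finset.card_eq_sum_card_fiberwise (f := σ) (t := univ) (fun _ _ => by simp), hm]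
      refine Finset.sum_congr rfl fun r _ => ?_
      rw [← hπ r]
      unfold xcount
      congr 1
      ext j
      simp only [mem_filter, mem_univ, true_and]
      tauto
    exact_mod_cast this
  have hone : ∀ π ∈ Ps, condPr n (k n) σ (p n) (q n) (s n)
      {ω | align (G1adjC ω) (G2adjC πstar ω) πstar ≤ align (G1adjC ω) (G2adjC πstar ω) π}
      ≤ Real.exp (-((1 + ε) * m * Real.log n)) := by
    intro π hπ
    simp only [hPs, mem_filter, mem_univ, true_and] at hπ
    refine (one_perm σ (p n) (q n) (s n) δ (hp01 n) (hq01 n) (hs01 n) hδ0 hδ1 hpn hqn πstar π).trans ?_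
    rw [Real.exp_le_exp, neg_le_neg_iff]
    have hps := pe_sum σ (p n) (q n) ((1 - δ) ^ 2 * n / k n) (hp01 n).1 (hq01 n).1 πstar π (by
      intro r
      rw [hπ r]
      have h1 := (hσ r).1
      have h2 := hx r
      have h3 : (1 - δ) * ((1 - δ) * n / k n) ≤ (1 - δ) * (Vcard σ r : ℝ) :=
        mul_le_mul_of_nonneg_left h1 (by linarith)
      have h4 : (1 - δ) ^ 2 * n / k n = (1 - δ) * ((1 - δ) * n / k n) := by ring
      rw [h4]
      linarith)
    simp_rw [hπ] at hps
    rw [hms] at hps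
    have h5 := mul_le_mul_of_nonneg_left hps
      (mul_nonneg (by linarith : 0 ≤ 1 - δ) (sq_nonneg (s n)))
    refine le_trans ?_ h5
    have h6 : (1 - δ) * s n ^ 2 * (m * ((1 - δ) ^ 2 * n / k n * (p n + ((k n : ℝ) - 1) * q n)))
      = (m : ℝ) * ((1 - δ) ^ 3 * (n * s n ^ 2 * (p n + ((k n : ℝ) - 1) * q n) / k n)) := by ring
    rw [h6]
    have h7 : (1 + ε) * m * Real.log n = m * ((1 + ε) * Real.log n) := by ring
    rw [h7]
    refine mul_le_mul_of_nonneg_left ?_ (Nat.cast_nonneg m)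
    have hδ3 : (1 - ε) ^ 2 ≤ (1 - δ) ^ 3 := by
      rw [hδ]; nlinarith [mul_pos hε0 hε0, mul_pos (mul_pos hε0 hε0) hε0, mul_pos hε0 (sub_pos.2 hε1), mul_pos (mul_pos hε0 hε0) (sub_pos.2 hε1)]
    have hε2 : (0 : ℝ) < 1 - ε := by linarith
    have hlog : 0 ≤ (1 + ε) * Real.log n := mul_nonneg (by linarith) hL
    calc (1 + ε) * Real.log n
        = (1 - ε) ^ 2 * ((1 + ε) * ((1 - ε)⁻¹) ^ 2 * Real.log n) := by field_simp
      _ ≤ (1 - δ) ^ 3 * ((1 + ε) * ((1 - ε)⁻¹) ^ 2 * Real.log n) := by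
          refine mul_le_mul_of_nonneg_right hδ3 ?_
          have : 0 ≤ ((1 - ε)⁻¹) ^ 2 := by positivity
          have h8 : (1 + ε) * ((1 - ε)⁻¹) ^ 2 * Real.log n
            = ((1 - ε)⁻¹) ^ 2 * ((1 + ε) * Real.log n) := by ring
          rw [h8]
          exact mul_nonneg this hlog
      _ ≤ _ := by
          refine mul_le_mul_of_nonneg_left hdeg.le ?_
          exact pow_nonneg (by linarith) 3
  have hunion : condPr n (k n) σ (p n) (q n) (s n)
      {ω | ∃ π : Equiv.Perm (Fin n),
                  lift π = lift (est (G1adjC ω) (G2adjC πstar ω))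
                    ∧ ∀ r, xcount σ πstar π r = x r}
      ≤ ∑ π ∈ Ps, condPr n (k n) σ (p n) (q n) (s n)
      {ω | align (G1adjC ω) (G2adjC πstar ω) πstar ≤ align (G1adjC ω) (G2adjC πstar ω) π} := by
    unfold condPr
    rw [Finset.sum_comm]
    refine Finset.sum_le_sum fun ω _ => ?_
    have hd := condDensity_nonneg σ (p n) (q n) (s n) (hp01 n) (hq01 n) (hs01 n)
    have hnn : ∀ π ∈ Ps, 0 ≤ Set.indicator {ω | align (G1adjC ω) (G2adjC πstar ω) πstar
        ≤ align (G1adjC ω) (G2adjC πstar ω) π} (condDensity n (k n) σ (p n) (q n) (s n)) ω :=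
      fun π _ => Set.indicator_nonneg (fun ω _ => hd ω) ω
    by_cases h : ω ∈ {ω | ∃ π : Equiv.Perm (Fin n),
                  lift π = lift (est (G1adjC ω) (G2adjC πstar ω))
                    ∧ ∀ r, xcount σ πstar π r = x r}
    · rw [Set.indicator_of_mem h]
      obtain ⟨π, h1, h2⟩ := h
      have hmem : π ∈ Ps := by simp only [hPs, mem_filter, mem_univ, true_and]; exact h2
      refine le_trans ?_ (Finset.single_le_sum hnn hmem)
      rw [Set.indicator_of_mem]
      show align (G1adjC ω) (G2adjC πstar ω) πstar ≤ align (G1adjC ω) (G2adjC πstar ω) π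
      rw [align_congr _ _ π _ _ h1]
      · exact hest _ _ _
      · intro i j
        simp only [G2adjC]
        rw [adj_symm, adj_symm ω.2.2]
    · rw [Set.indicator_of_notMem h]
      exact Finset.sum_nonneg hnn
  refine hunion.trans ((Finset.sum_le_sum hone).trans ?_)
  rw [Finset.sum_const, nsmul_eq_mul]
  refine (mul_le_mul_of_nonneg_right hcard (Real.exp_pos _).le).trans (le_of_eq ?_)
  rw [Real.rpow_def_of_pos hn0, ← Real.exp_log (pow_pos hn0 m), Real.log_pow, ← Real.exp_add]
  congr 1
  ring

end CSBM
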